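/- arXiv:2106.01034 — 10 statements merged into one kernel-verified Lean document; each statement's English description precedes it below -/
import Mathlib

section
/- Let ψ_i(x) = x + Σ_{j≠i} φ_{i,j}(x) with φ_{i,j}(x) = ⌊(x + d_i)/Q_i⌋·Q_j + Q_j + d_j. Then the lower pseudo-inverse of ψ_i is exactly γ_i: for every y ≥ 0, ψ_i↓(y) = (λ_1 ⊗ ν_{Q_i,Q_tot})([y − ψ_i(Q_i − d_i)]^+) + min([y − Σ_{j≠i}(Q_j + d_j)]^+, Q_i − d_i). -/
open Finset Set

/-- Positive part `[x]^+ = max(x,0)`. -/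
noncomputable def pospart (x : ℝ) : ℝ := max x 0

/-- Stair function `ν_{a,b}(t) = a⌈t/b⌉`. -/
noncomputable def stair (a b t : ℝ) : ℝ := a * (Int.ceil (t / b) : ℝ)

/-- Min-plus convolution on `[0,t]`. -/
noncomputable def mpConv (f g : ℝ → ℝ) (t : ℝ) : ℝ :=
  sInf ((fun s => f (t - s) + g s) '' Set.Icc 0 t)

/-- Min-plus deconvolution `(f ⊘ g)(t) = sup_{s ≥ 0} (f(t+s) − g(s))`. -/
noncomputable def mpDeconv (f g : ℝ → ℝ) (t : ℝ) : ℝ :=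
  sSup ((fun s => f (t + s) - g s) '' Set.Ici 0)

/-- Lower pseudo-inverse `f↓(y) = inf {x ≥ 0 | f(x) ≥ y}`. -/
noncomputable def lpi (f : ℝ → ℝ) (y : ℝ) : ℝ :=
  sInf {x : ℝ | 0 ≤ x ∧ y ≤ f x}

/-- Real remainder of `x` modulo `Q`, lying in `[0,Q)`. -/
noncomputable def rmod (x Q : ℝ) : ℝ := x - Q * (Int.floor (x / Q) : ℝ)

/-- Horizontal deviation `h(α,β) = sup_{t ≥ 0} inf {e ≥ 0 | α(t) ≤ β(t+e)}`. -/
noncomputable def hDev (f g : ℝ → ℝ) : ℝ :=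
  sSup {z : ℝ | ∃ t : ℝ, 0 ≤ t ∧ z = sInf {e : ℝ | 0 ≤ e ∧ f t ≤ g (t + e)}}

/-- Non-decreasing closure `g↑(t) = sup_{0 ≤ s ≤ t} g(s)`. -/
noncomputable def ndClosure (g : ℝ → ℝ) (t : ℝ) : ℝ :=
  sSup (g '' Set.Icc 0 t)

/-- Non-decreasing and non-negative closure `[g]^+↑(t) = sup_{0 ≤ s ≤ t} max(g(s),0)`. -/
noncomputable def posNdClosure (g : ℝ → ℝ) (t : ℝ) : ℝ :=
  sSup ((fun s => max (g s) 0) '' Set.Icc 0 t)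

/-- Interference function `φ_{i,j}(x) = ⌊(x+d_i)/Q_i⌋·Q_j + Q_j + d_j`. -/
noncomputable def phi {n : ℕ} (Q d : Fin n → ℝ) (i j : Fin n) (x : ℝ) : ℝ :=
  (Int.floor ((x + d i) / Q i) : ℝ) * Q j + Q j + d j

/-- `ψ_i(x) = x + Σ_{j ≠ i} φ_{i,j}(x)`. -/
noncomputable def psi {n : ℕ} (Q d : Fin n → ℝ) (i : Fin n) (x : ℝ) : ℝ :=
  x + ∑ j ∈ Finset.univ.erase i, phi Q d i j x

/-- `ψ_i^J(x) = x + Σ_{j ∈ J} φ_{i,j}(x)`. -/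
noncomputable def psiJ {n : ℕ} (Q d : Fin n → ℝ) (i : Fin n) (J : Finset (Fin n)) (x : ℝ) : ℝ :=
  x + ∑ j ∈ J, phi Q d i j x

/-- The non-convex DRR curve
`γ_i(x) = (λ_1 ⊗ ν_{Q_i,Q_tot})([x − ψ_i(Q_i−d_i)]^+) + min([x − Σ_{j≠i}(Q_j+d_j)]^+, Q_i−d_i)`. -/
noncomputable def gam {n : ℕ} (Q d : Fin n → ℝ) (i : Fin n) (x : ℝ) : ℝ :=
  mpConv (fun t => t) (stair (Q i) (∑ j, Q j)) (pospart (x - psi Q d i (Q i - d i)))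
  + min (pospart (x - ∑ j ∈ Finset.univ.erase i, (Q j + d j))) (Q i - d i)

lemma mpConv_stair_isLeast (q S t : ℝ) (hq : 0 < q) (hS : 0 ≤ S) (ht : 0 ≤ t) (k : ℤ)
    (hk : 0 ≤ k) (h1 : (k : ℝ) * (q + S) ≤ t) (h2 : t < ((k : ℝ) + 1) * (q + S)) :
    mpConv (fun t => t) (stair q (q + S)) t = k * q + min (t - k * (q + S)) q := by
  have hT : 0 < q + S := by linarith
  have hk' : (0 : ℝ) ≤ k := by exact_mod_cast hk
  unfold mpConv
  have lb : ∀ b ∈ ((fun s => (fun t : ℝ => t) (t - s) + stair q (q + S) s) '' Set.Icc 0 t),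
      k * q + min (t - k * (q + S)) q ≤ b := by
    rintro b ⟨s, ⟨hs0, hst⟩, rfl⟩
    simp only [stair]
    have hc : s ≤ (⌈s / (q + S)⌉ : ℝ) * (q + S) := by
      rw [← div_le_iff₀ hT]; exact Int.le_ceil _
    generalize ⌈s / (q + S)⌉ = m at hc
    rcases le_or_gt m k with hm | hm
    · have hm' : (m : ℝ) ≤ k := by exact_mod_cast hm
      have := min_le_left (t - k * (q + S)) q
      nlinarith [mul_nonneg (sub_nonneg.2 hm') hS]
    · have hm' : (k : ℝ) + 1 ≤ m := by exact_mod_cast hm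
      have := min_le_right (t - k * (q + S)) q
      nlinarith
  apply le_antisymm
  · have bdd : BddBelow ((fun s => (fun t : ℝ => t) (t - s) + stair q (q + S) s) '' Set.Icc 0 t) :=
      ⟨_, lb⟩
    rcases le_total (t - k * (q + S)) q with h | h
    · rw [min_eq_left h]
      refine csInf_le bdd ⟨k * (q + S), ⟨by positivity, h1⟩, ?_⟩
      simp only [stair]
      rw [mul_div_cancel_right₀ _ hT.ne', Int.ceil_intCast]
      ring
    · rw [min_eq_right h]
      refine (csInf_le bdd ⟨t, ⟨ht, le_refl _⟩, rfl⟩).trans ?_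
      simp only [stair]
      have : ⌈t / (q + S)⌉ ≤ k + 1 := by
        rw [Int.ceil_le, div_le_iff₀ hT]; push_cast; exact h2.le
      have : (⌈t / (q + S)⌉ : ℝ) ≤ k + 1 := by exact_mod_cast this
      nlinarith
  · exact le_csInf ⟨_, t, ⟨ht, le_refl _⟩, rfl⟩ lb

lemma psi_eq {n : ℕ} (Q d : Fin n → ℝ) (i : Fin n) (x : ℝ) :
    psi Q d i x = x + (⌊(x + d i) / Q i⌋ : ℝ) * (∑ j ∈ Finset.univ.erase i, Q j)
      + ∑ j ∈ Finset.univ.erase i, (Q j + d j) := by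
  simp only [psi, phi, Finset.mul_sum, add_assoc, Finset.sum_add_distrib]

theorem psi_lower_pseudo_inverse_eq_gam {n : ℕ} (hn : 2 ≤ n) (Q d : Fin n → ℝ)
    (hQ : ∀ j, 0 < Q j) (hd : ∀ j, 0 ≤ d j ∧ d j < Q j) (i : Fin n) :
    ∀ y : ℝ, 0 ≤ y → lpi (psi Q d i) y = gam Q d i y := by
  intro y _
  have hq := hQ i
  obtain ⟨hd0, hdq⟩ := hd i
  have hS : 0 ≤ ∑ j ∈ Finset.univ.erase i, Q j := Finset.sum_nonneg fun j _ => (hQ j).le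
  have hTot : ∑ j, Q j = Q i + ∑ j ∈ Finset.univ.erase i, Q j :=
    (Finset.add_sum_erase _ _ (Finset.mem_univ i)).symm
  unfold gam lpi
  simp only [psi_eq, hTot, sub_add_cancel, div_self hq.ne', Int.floor_one]
  generalize ∑ j ∈ Finset.univ.erase i, Q j = S at *
  generalize ∑ j ∈ Finset.univ.erase i, (Q j + d j) = D at *
  generalize Q i = q at *
  generalize d i = e at *
  have fl : ∀ (x : ℝ) (m : ℤ), x + e < ((m : ℝ) + 1) * q →
      (⌊(x + e) / q⌋ : ℝ) * S ≤ m * S := by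
    intro x m h
    have : ⌊(x + e) / q⌋ < m + 1 := by
      rw [Int.floor_lt, div_lt_iff₀ hq]; push_cast; exact h
    have : ⌊(x + e) / q⌋ ≤ m := by omega
    exact mul_le_mul_of_nonneg_right (by exact_mod_cast this) hS
  have fg : ∀ (x : ℝ) (m : ℤ), (m : ℝ) * q ≤ x + e →
      (m : ℝ) * S ≤ (⌊(x + e) / q⌋ : ℝ) * S := by
    intro x m h
    have : m ≤ ⌊(x + e) / q⌋ := by
      rw [Int.le_floor, le_div_iff₀ hq]; exact h
    exact mul_le_mul_of_nonneg_right (by exact_mod_cast this) hS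
  refine IsLeast.csInf_eq ?_
  push_cast
  rcases le_or_gt (y - (q - e + 1 * S + D)) 0 with h0 | h0
  · have hp : pospart (y - (q - e + 1 * S + D)) = 0 := max_eq_right h0
    rw [hp, mpConv_stair_isLeast q S 0 hq hS le_rfl 0 le_rfl (by simp) (by simp; linarith)]
    have e1 : ((0 : ℤ) : ℝ) * q + min (0 - ((0 : ℤ) : ℝ) * (q + S)) q = 0 := by
      simp [hq.le]
    rw [e1, zero_add]
    unfold pospart
    constructor
    · refine ⟨le_min (le_max_right _ _) (by linarith), ?_⟩
      rcases le_total (max (y - D) 0) (q - e) with h | h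
      · rw [min_eq_left h]
        have := fg (max (y - D) 0) 0 (by simp; have := le_max_right (y - D) 0; linarith)
        have := le_max_left (y - D) 0
        push_cast at *
        linarith
      · rw [min_eq_right h]
        have := fg (q - e) 1 (by simp)
        push_cast at *
        linarith
    · rintro x ⟨hx0, hx⟩
      by_contra! hlt
      obtain ⟨ha, hb⟩ := lt_min_iff.1 hlt
      have := fl x 0 (by push_cast; linarith)
      push_cast at this
      rcases lt_max_iff.1 ha with h | h <;> linarith
  · have hp : pospart (y - (q - e + 1 * S + D)) = y - (q - e + 1 * S + D) := max_eq_left h0.le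
    have hm : min (pospart (y - D)) (q - e) = q - e := by
      apply min_eq_right
      exact le_trans (by linarith) (le_max_left (y - D) 0)
    rw [hp, hm]
    obtain ⟨t, ht⟩ : ∃ t, t = y - (q - e + 1 * S + D) := ⟨_, rfl⟩
    rw [← ht] at h0 ⊢
    have hT : 0 < q + S := by linarith
    obtain ⟨k, hk⟩ : ∃ k, k = ⌊t / (q + S)⌋ := ⟨_, rfl⟩
    have hk0 : 0 ≤ k := hk ▸ Int.floor_nonneg.2 (by positivity)
    have h1 : (k : ℝ) * (q + S) ≤ t := by
      rw [← le_div_iff₀ hT, hk]; exact Int.floor_le _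
    have h2 : t < ((k : ℝ) + 1) * (q + S) := by
      rw [← div_lt_iff₀ hT, hk]; exact Int.lt_floor_add_one _
    rw [mpConv_stair_isLeast q S t hq hS h0.le k hk0 h1 h2]
    have hk' : (0 : ℝ) ≤ k := by exact_mod_cast hk0
    have hkq : 0 ≤ (k : ℝ) * q := by positivity
    constructor
    · refine ⟨?_, ?_⟩
      · have : 0 ≤ min (t - k * (q + S)) q := le_min (by linarith) hq.le
        linarith
      · rcases le_total (t - k * (q + S)) q with h | h
        · rw [min_eq_left h]
          have := fg (k * q + (t - k * (q + S)) + (q - e)) (k + 1) (by push_cast; linarith)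
          push_cast at this
          linarith
        · rw [min_eq_right h]
          have := fg (k * q + q + (q - e)) (k + 2) (by push_cast; linarith)
          push_cast at this
          linarith
    · rintro x ⟨hx0, hx⟩
      by_contra! hlt
      have ha := min_le_left (t - k * (q + S)) q
      have hb := min_le_right (t - k * (q + S)) q
      have := fl x (k + 1) (by push_cast; linarith)
      push_cast at this
      linarith
end

section
/- (Theorem 1, non-convex strict service curve for DRR.) Let A_1,…,A_n and D_1,…,D_n be nondecreasing cumulative input/output functions on ℝ≥0 with D_j ≤ A_j and A_j(0) = D_j(0) = 0, and let β : ℝ≥0 → ℝ≥0 be nondecreasing. Assume: (i) for every interval (s,t] that is backlogged for flow i (i.e., A_i(u) > D_i(u) for all u ∈ (s,t]), Σ_{j=1}^n (D_j(t) − D_j(s)) ≥ β(t−s); and (ii) for every such interval and every j ≠ i, D_j(t) − D_j(s) ≤ φ_{i,j}(D_i(t) − D_i(s)). Then γ_i ∘ β is a strict service curve for flow i: for every interval (s,t] backlogged for flow i, D_i(t) − D_i(s) ≥ γ_i(β(t−s)). -/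
open Finset Set

theorem mpConv_le_aux (a b w s : ℝ) (ha : 0 ≤ a) (hb : 0 < b) (hs : 0 ≤ s) (hsw : s ≤ w) :
    mpConv (fun t => t) (stair a b) w ≤ w - s + a * (Int.ceil (s / b) : ℝ) := by
  unfold mpConv
  apply csInf_le
  · refine ⟨0, ?_⟩
    rintro _ ⟨u, hu, rfl⟩
    have h1 : (0 : ℤ) ≤ Int.ceil (u / b) := Int.ceil_nonneg (div_nonneg hu.1 hb.le)
    have h2 : (0 : ℝ) ≤ (Int.ceil (u / b) : ℝ) := by exact_mod_cast h1
    have h3 := mul_nonneg ha h2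
    have h4 := hu.2
    simp only [stair]
    linarith
  · exact ⟨s, ⟨hs, hsw⟩, rfl⟩

theorem psi_eq_aux {n : ℕ} (Q d : Fin n → ℝ) (i : Fin n) (x : ℝ) :
    psi Q d i x = x + ((Int.floor ((x + d i) / Q i) : ℝ) * ∑ j ∈ Finset.univ.erase i, Q j
      + ∑ j ∈ Finset.univ.erase i, (Q j + d j)) := by
  simp only [psi, phi, Finset.mul_sum, ← Finset.sum_add_distrib, add_assoc]

theorem gam_le_aux {n : ℕ} (Q d : Fin n → ℝ)
    (hQ : ∀ j, 0 < Q j) (hd : ∀ j, 0 ≤ d j ∧ d j < Q j) (i : Fin n) (x y : ℝ) (hx : 0 ≤ x)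
    (hy : y ≤ psi Q d i x) : gam Q d i y ≤ x := by
  have hqi := hQ i
  obtain ⟨hd0, hdq⟩ := hd i
  have hS : 0 ≤ ∑ j ∈ Finset.univ.erase i, Q j := Finset.sum_nonneg fun j _ => (hQ j).le
  have htot : ∑ j, Q j = Q i + ∑ j ∈ Finset.univ.erase i, Q j :=
    (Finset.add_sum_erase _ _ (Finset.mem_univ i)).symm
  have hone : (Q i - d i + d i) / Q i = 1 := by field_simp; ring
  unfold gam
  rw [psi_eq_aux] at hy ⊢
  rw [hone, htot]
  generalize (∑ j ∈ Finset.univ.erase i, Q j) = S at *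
  generalize (∑ j ∈ Finset.univ.erase i, (Q j + d j)) = T at *
  have hk0 : (0 : ℤ) ≤ ⌊(x + d i) / Q i⌋ := Int.floor_nonneg.2 (by positivity)
  have hk1 : (⌊(x + d i) / Q i⌋ : ℝ) * Q i ≤ x + d i := by
    rw [← le_div_iff₀ hqi]; exact Int.floor_le _
  have hk2 : x + d i < ((⌊(x + d i) / Q i⌋ : ℝ) + 1) * Q i := by
    rw [← div_lt_iff₀ hqi]; exact Int.lt_floor_add_one _
  generalize ⌊(x + d i) / Q i⌋ = k at *
  simp only [Int.floor_one, Int.cast_one, one_mul]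
  have htp : 0 < Q i + S := by linarith
  rcases hk0.eq_or_lt with h | h
  · subst h
    simp only [Int.cast_zero, zero_mul, zero_add, one_mul] at hy hk2
    have hw : pospart (y - (Q i - d i + (S + T))) = 0 := max_eq_right (by linarith)
    rw [hw]
    have h1 := mpConv_le_aux (Q i) (Q i + S) 0 0 hqi.le htp le_rfl le_rfl
    have h2 : pospart (y - T) ≤ x := max_le (by linarith) hx
    have h3 := min_le_left (pospart (y - T)) (Q i - d i)
    simp at h1
    linarith
  · have hk : (1 : ℝ) ≤ k := by exact_mod_cast h
    have hz : Q i * (k - 1) ≤ x - (Q i - d i) := by nlinarith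
    have hp : 0 ≤ Q i * ((k : ℝ) - 1) := mul_nonneg hqi.le (by linarith)
    have hpS : 0 ≤ S * ((k : ℝ) - 1) := mul_nonneg hS (by linarith)
    have hw0 : 0 ≤ pospart (y - (Q i - d i + (S + T))) := le_max_right _ _
    have hw : pospart (y - (Q i - d i + (S + T))) ≤ x - (Q i - d i) + S * (k - 1) :=
      max_le (by linarith) (by linarith)
    have h3 := min_le_right (pospart (y - T)) (Q i - d i)
    generalize pospart (y - (Q i - d i + (S + T))) = w at *
    suffices mpConv (fun t => t) (stair (Q i) (Q i + S)) w ≤ x - (Q i - d i) by linarith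
    rcases le_total w ((k - 1) * (Q i + S)) with hc | hc
    · have h1 := mpConv_le_aux (Q i) (Q i + S) w w hqi.le htp hw0 le_rfl
      have h2 : ⌈w / (Q i + S)⌉ ≤ k - 1 := by
        rw [Int.ceil_le, div_le_iff₀ htp]; push_cast; exact hc
      have h4 : (⌈w / (Q i + S)⌉ : ℝ) ≤ k - 1 := by exact_mod_cast h2
      have h5 := mul_le_mul_of_nonneg_left h4 hqi.le
      linarith
    · have h1 := mpConv_le_aux (Q i) (Q i + S) w ((k - 1) * (Q i + S)) hqi.le htp
        (by nlinarith) hc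
      have h2 : ((k : ℝ) - 1) * (Q i + S) / (Q i + S) = ((k - 1 : ℤ) : ℝ) := by
        push_cast; field_simp
      rw [h2, Int.ceil_intCast] at h1
      push_cast at h1
      linarith

theorem drr_nonconvex_strict_service_curve {n : ℕ} (hn : 2 ≤ n) (Q d : Fin n → ℝ)
    (hQ : ∀ j, 0 < Q j) (hd : ∀ j, 0 ≤ d j ∧ d j < Q j) (i : Fin n)
    (A D : Fin n → ℝ → ℝ) (β : ℝ → ℝ)
    (hA : ∀ j, MonotoneOn (A j) (Set.Ici 0)) (hD : ∀ j, MonotoneOn (D j) (Set.Ici 0))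
    (hDA : ∀ j, ∀ t : ℝ, 0 ≤ t → D j t ≤ A j t)
    (hA0 : ∀ j, A j 0 = 0) (hD0 : ∀ j, D j 0 = 0)
    (hβ : MonotoneOn β (Set.Ici 0))
    (hagg : ∀ s t : ℝ, 0 ≤ s → s ≤ t → (∀ u ∈ Set.Ioc s t, D i u < A i u) →
      β (t - s) ≤ ∑ j, (D j t - D j s))
    (hphi : ∀ s t : ℝ, 0 ≤ s → s ≤ t → (∀ u ∈ Set.Ioc s t, D i u < A i u) →
      ∀ j ∈ Finset.univ.erase i, D j t - D j s ≤ phi Q d i j (D i t - D i s)) :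
    ∀ s t : ℝ, 0 ≤ s → s ≤ t → (∀ u ∈ Set.Ioc s t, D i u < A i u) →
      gam Q d i (β (t - s)) ≤ D i t - D i s := by
  intro s t hs hst hb
  have hx : 0 ≤ D i t - D i s := sub_nonneg.2 (hD i hs (hs.trans hst) hst)
  apply gam_le_aux Q d hQ hd i _ _ hx
  refine (hagg s t hs hst hb).trans ?_
  rw [← Finset.add_sum_erase _ _ (Finset.mem_univ i)]
  exact add_le_add le_rfl (Finset.sum_le_sum (hphi s t hs hst hb))
end

section
/- The function γ_i is nondecreasing and superadditive on ℝ≥0, i.e., γ_i(x + y) ≥ γ_i(x) + γ_i(y) for all x, y ≥ 0; consequently, for every nondecreasing superadditive β : ℝ≥0 → ℝ≥0 with β(0) = 0, the composition γ_i ∘ β is superadditive. -/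
open Finset Set

/-- Closed form of the staircase convolution, extended to all reals. -/
noncomputable def stF (q T u : ℝ) : ℝ :=
  (Int.floor (u / T) : ℝ) * q + min (u - (Int.floor (u / T) : ℝ) * T) q

lemma stF_bounds (T u : ℝ) (hT : 0 < T) :
    (Int.floor (u / T) : ℝ) * T ≤ u ∧ u < ((Int.floor (u / T) : ℝ) + 1) * T := by
  constructor
  · have := Int.floor_le (u / T)
    rwa [le_div_iff₀ hT] at this
  · have := Int.lt_floor_add_one (u / T)
    rwa [div_lt_iff₀ hT] at this

lemma stF_ge (q T u : ℝ) (hq : 0 < q) (hqT : q < T) (m : ℤ) :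
    (m : ℝ) * q + min (u - m * T) q ≤ stF q T u := by
  have hT : 0 < T := hq.trans hqT
  obtain ⟨h1, h2⟩ := stF_bounds T u hT
  unfold stF
  set k := Int.floor (u / T)
  rcases lt_trichotomy m k with h | h | h
  · have h' : (m : ℝ) + 1 ≤ k := by exact_mod_cast h
    have : 0 ≤ min (u - k * T) q := le_min (by linarith) hq.le
    have h3 := min_le_right (u - m * T) q
    nlinarith
  · rw [h]
  · have h' : (k : ℝ) + 1 ≤ m := by exact_mod_cast h
    have h3 := min_le_left (u - m * T) q
    have h4 : (0:ℝ) ≤ ((m : ℝ) - (k + 1)) * (T - q) :=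
      mul_nonneg (by linarith) (by linarith)
    rcases le_total (u - k * T) q with h5 | h5
    · rw [min_eq_left h5]; nlinarith
    · rw [min_eq_right h5]; nlinarith

lemma stF_mono (q T : ℝ) (hq : 0 < q) (hqT : q < T) : Monotone (stF q T) := by
  intro u v h
  refine le_trans ?_ (stF_ge q T v hq hqT (Int.floor (u / T)))
  unfold stF
  gcongr

lemma mpConv_eq (q T t : ℝ) (hq : 0 < q) (hqT : q < T) (ht : 0 ≤ t) :
    mpConv (fun t => t) (stair q T) t = stF q T t := by
  have hT : 0 < T := hq.trans hqT
  obtain ⟨h1, h2⟩ := stF_bounds T t hT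
  have hk0 : 0 ≤ Int.floor (t / T) := Int.floor_nonneg.2 (by positivity)
  have key : ∀ s ∈ Set.Icc 0 t, stF q T t ≤ (t - s) + stair q T s := by
    intro s hs
    unfold stF stair
    have hm : s ≤ (Int.ceil (s / T) : ℝ) * T := by
      have := Int.le_ceil (s / T)
      rwa [div_le_iff₀ hT] at this
    set k := Int.floor (t / T)
    set m := Int.ceil (s / T)
    have h3 := min_le_left (t - k * T) q
    have h4 := min_le_right (t - k * T) q
    have hs1 := hs.1
    have hs2 := hs.2
    rcases lt_or_ge k m with h | h
    · have h' : (k : ℝ) + 1 ≤ m := by exact_mod_cast h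
      nlinarith
    · have h' : (m : ℝ) ≤ k := by exact_mod_cast h
      have : (0:ℝ) ≤ ((k : ℝ) - m) * (T - q) := mul_nonneg (by linarith) (by linarith)
      nlinarith
  have hb : BddBelow ((fun s => (fun t => t) (t - s) + stair q T s) '' Set.Icc 0 t) := by
    refine ⟨stF q T t, ?_⟩
    rintro _ ⟨s, hs, rfl⟩
    exact key s hs
  unfold mpConv
  apply le_antisymm
  · have hk0' : (0:ℝ) ≤ (Int.floor (t / T) : ℝ) := by exact_mod_cast hk0
    have a1 := csInf_le hb ⟨(Int.floor (t / T) : ℝ) * T, ⟨by positivity, h1⟩, rfl⟩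
    have a2 := csInf_le hb ⟨t, ⟨ht, le_rfl⟩, rfl⟩
    have e1 : stair q T ((Int.floor (t / T) : ℝ) * T) = q * (Int.floor (t / T) : ℝ) := by
      unfold stair
      rw [mul_div_cancel_right₀ _ hT.ne', Int.ceil_intCast]
    have e2 : stair q T t ≤ q * ((Int.floor (t / T) : ℝ) + 1) := by
      unfold stair
      have : (Int.ceil (t / T) : ℝ) ≤ (Int.floor (t / T) : ℝ) + 1 := by
        exact_mod_cast Int.ceil_le_floor_add_one (t / T)
      gcongr
    simp only [e1] at a1
    simp only [sub_self, zero_add] at a2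
    unfold stF
    rw [← sub_le_iff_le_add', le_min_iff]
    constructor <;> linarith
  · apply le_csInf
    · exact ⟨_, ⟨t, ⟨ht, le_rfl⟩, rfl⟩⟩
    · rintro _ ⟨s, hs, rfl⟩
      exact key s hs

lemma stF_zero (q T : ℝ) (hq : 0 < q) : stF q T 0 = 0 := by
  simp [stF, hq.le]

lemma closed_form (q T e u : ℝ) (hq : 0 < q) (hqT : q < T) (he : 0 < e) (heq : e ≤ q) :
    stF q T (max u 0) + min (max (u + (T - q) + e) 0) e = max (stF q T u + e) 0 := by
  have hT : 0 < T := hq.trans hqT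
  have hm := stF_mono q T hq hqT
  have h0 := stF_zero q T hq
  rcases le_total 0 u with h | h
  · have := hm h
    rw [max_eq_left h, max_eq_left (by linarith : 0 ≤ u + (T - q) + e),
      min_eq_right (by linarith), max_eq_left (by linarith)]
  · rw [max_eq_right h, h0, zero_add]
    have hle := hm h
    rcases le_total (-(T - q)) u with h1 | h1
    · have := stF_ge q T u hq hqT (-1)
      rw [min_eq_right (by push_cast; linarith)] at this
      push_cast at this
      have : stF q T u = 0 := by linarith
      rw [this, max_eq_left (by linarith : 0 ≤ u + (T - q) + e),
        min_eq_right (by linarith), max_eq_left (by linarith), zero_add]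
    · obtain ⟨h2, h3⟩ := stF_bounds T u hT
      rcases le_or_gt (-T) u with h4 | h4
      · have hf : Int.floor (u / T) = -1 := by
          rw [Int.floor_eq_iff]
          push_cast
          constructor
          · rw [le_div_iff₀ hT]; linarith
          · rw [div_lt_iff₀ hT]; linarith
        have : stF q T u = u + (T - q) := by
          unfold stF
          rw [hf, min_eq_left (by push_cast; linarith)]
          push_cast; ring
        rw [this, min_eq_left]
        exact max_le (by linarith) he.le
      · have hk : Int.floor (u / T) < -1 := by
          rw [Int.floor_lt, div_lt_iff₀ hT]; push_cast; linarith
        have hk' : (Int.floor (u / T) : ℝ) + 1 ≤ -1 := by exact_mod_cast hk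
        have : stF q T u ≤ -q := by
          unfold stF
          have := min_le_right (u - (Int.floor (u / T) : ℝ) * T) q
          nlinarith
        rw [max_eq_right (by linarith : u + (T - q) + e ≤ 0), min_eq_left he.le,
          max_eq_right (by linarith)]

lemma stF_super (q T e c a b : ℝ) (hq : 0 < q) (hqT : q < T) (heq : e ≤ q)
    (hc : e + 2 * (T - q) ≤ c) :
    stF q T a + stF q T b + e ≤ stF q T (a + b + c) := by
  refine le_trans ?_ (stF_ge q T (a + b + c) hq hqT
    (Int.floor (a / T) + Int.floor (b / T) + 2))
  unfold stF
  push_cast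
  have a1 := min_le_left (a - (Int.floor (a / T) : ℝ) * T) q
  have a2 := min_le_right (a - (Int.floor (a / T) : ℝ) * T) q
  have b1 := min_le_left (b - (Int.floor (b / T) : ℝ) * T) q
  have b2 := min_le_right (b - (Int.floor (b / T) : ℝ) * T) q
  rw [← sub_le_iff_le_add', le_min_iff]
  constructor <;> linarith

lemma gam_eq {n : ℕ} (hn : 2 ≤ n) (Q d : Fin n → ℝ)
    (hQ : ∀ j, 0 < Q j) (hd : ∀ j, 0 ≤ d j ∧ d j < Q j) (i : Fin n) :
    ∃ q T e c : ℝ, 0 < q ∧ q < T ∧ 0 < e ∧ e ≤ q ∧ e + 2 * (T - q) ≤ c ∧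
      ∀ x, gam Q d i x = max (stF q T (x - c) + e) 0 := by
  have hsum : ∑ j ∈ Finset.univ.erase i, Q j + Q i = ∑ j, Q j :=
    Finset.sum_erase_add _ _ (Finset.mem_univ i)
  have hR : 0 < ∑ j ∈ Finset.univ.erase i, Q j := by
    apply Finset.sum_pos (fun j _ => hQ j)
    rw [← Finset.card_pos, Finset.card_erase_of_mem (Finset.mem_univ i)]
    simp; omega
  have hD : 0 ≤ ∑ j ∈ Finset.univ.erase i, d j := Finset.sum_nonneg (fun j _ => (hd j).1)
  have hpsi : psi Q d i (Q i - d i) = (Q i - d i) + 2 * ∑ j ∈ Finset.univ.erase i, Q j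
      + ∑ j ∈ Finset.univ.erase i, d j := by
    unfold psi phi
    rw [sub_add_cancel, div_self (hQ i).ne', Int.floor_one]
    simp only [Int.cast_one, one_mul, Finset.sum_add_distrib]
    ring
  have hi := hd i
  refine ⟨Q i, ∑ j, Q j, Q i - d i, psi Q d i (Q i - d i), hQ i, by linarith, by linarith,
    by linarith, by rw [hpsi]; linarith, fun x => ?_⟩
  rw [← closed_form _ _ _ _ (hQ i) (by linarith) (by linarith) (by linarith)]
  unfold gam pospart
  rw [mpConv_eq _ _ _ (hQ i) (by linarith) (le_max_right _ _)]
  congr 4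
  rw [hpsi, Finset.sum_add_distrib]
  linarith

theorem gam_monotone_superadditive {n : ℕ} (hn : 2 ≤ n) (Q d : Fin n → ℝ)
    (hQ : ∀ j, 0 < Q j) (hd : ∀ j, 0 ≤ d j ∧ d j < Q j) (i : Fin n) :
    MonotoneOn (gam Q d i) (Set.Ici 0) ∧
    (∀ x y : ℝ, 0 ≤ x → 0 ≤ y → gam Q d i x + gam Q d i y ≤ gam Q d i (x + y)) ∧
    (∀ β : ℝ → ℝ, MonotoneOn β (Set.Ici 0) → β 0 = 0 → (∀ t : ℝ, 0 ≤ t → 0 ≤ β t) →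
      (∀ x y : ℝ, 0 ≤ x → 0 ≤ y → β x + β y ≤ β (x + y)) →
      ∀ x y : ℝ, 0 ≤ x → 0 ≤ y →
        gam Q d i (β x) + gam Q d i (β y) ≤ gam Q d i (β (x + y))) := by
  obtain ⟨q, T, e, c, hq, hqT, he, heq, hc, hg⟩ := gam_eq hn Q d hQ hd i
  have hmono : Monotone (gam Q d i) := by
    intro x y h
    rw [hg, hg]
    have := stF_mono q T hq hqT (sub_le_sub_right h c)
    gcongr
  have hsup : ∀ x y : ℝ, 0 ≤ x → 0 ≤ y → gam Q d i x + gam Q d i y ≤ gam Q d i (x + y) := by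
    intro x y hx hy
    have m1 := hmono (by linarith : x ≤ x + y)
    have m2 := hmono (by linarith : y ≤ x + y)
    rcases le_total (stF q T (x - c) + e) 0 with h1 | h1
    · have : gam Q d i x = 0 := by rw [hg, max_eq_right h1]
      linarith
    rcases le_total (stF q T (y - c) + e) 0 with h2 | h2
    · have : gam Q d i y = 0 := by rw [hg, max_eq_right h2]
      linarith
    have h3 := stF_super q T e c (x - c) (y - c) hq hqT heq hc
    rw [hg x, hg y, hg (x + y), max_eq_left h1, max_eq_left h2]
    refine le_trans ?_ (le_max_left _ _)
    rw [show x - c + (y - c) + c = x + y - c by ring] at h3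
    linarith
  refine ⟨hmono.monotoneOn _, hsup, ?_⟩
  intro β _ _ hβ hβs x y hx hy
  exact (hsup _ _ (hβ x hx) (hβ y hy)).trans (hmono (hβs x y hx hy))
end

section
/- (Theorem 3, case 1: closed-form delay bound for a token-bucket arrival curve.) Let c > 0, T ≥ 0 and define β_i^0(t) = γ_i(c·[t − T]^+). Let r, b > 0 with r ≤ (Q_i/Q_tot)·c, and let α(t) = r·t + b for t > 0 and α(0) = 0. Let τ = (Q_i − ((b + d_i) mod Q_i))/r, where x mod Q denotes the real remainder of x modulo Q lying in [0, Q). Then the horizontal deviation satisfies h(α, β_i^0) = T + max( ψ_i(b)/c , ψ_i(α(τ))/c − τ ). -/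
open Finset Set

/-- Abstract DRR curve. -/
noncomputable def gabs (q δ S D x : ℝ) : ℝ :=
  mpConv (fun t => t) (stair q (q + S)) (pospart (x - (q - δ + S + D)))
  + min (pospart (x - D)) (q - δ)

lemma stair_nonneg_aux {q F s : ℝ} (hq : 0 < q) (hF : 0 < F) (hs : 0 ≤ s) : 0 ≤ stair q F s := by
  unfold stair
  have : (0 : ℤ) ≤ ⌈s / F⌉ := Int.ceil_nonneg (by positivity)
  have h2 : (0 : ℝ) ≤ (⌈s / F⌉ : ℝ) := by exact_mod_cast this
  positivity

lemma mpConv_le_aux_s3 {q F t s : ℝ} (hq : 0 < q) (hF : 0 < F) (hs : 0 ≤ s) (hst : s ≤ t) :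
    mpConv (fun t => t) (stair q F) t ≤ t - s + stair q F s := by
  unfold mpConv
  apply csInf_le
  · refine ⟨0, ?_⟩
    rintro _ ⟨u, ⟨hu0, hu1⟩, rfl⟩
    have := stair_nonneg_aux hq hF hu0
    simp only
    linarith
  · exact ⟨s, ⟨hs, hst⟩, rfl⟩

lemma le_mpConv_aux {q F t z : ℝ} (ht : 0 ≤ t)
    (h : ∀ s, 0 ≤ s → s ≤ t → z ≤ t - s + stair q F s) :
    z ≤ mpConv (fun t => t) (stair q F) t := by
  unfold mpConv
  apply le_csInf
  · exact ⟨_, ⟨0, ⟨le_refl _, ht⟩, rfl⟩⟩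
  · rintro _ ⟨u, ⟨hu0, hu1⟩, rfl⟩
    exact h u hu0 hu1

lemma mpConv_nonneg_aux {q F t : ℝ} (hq : 0 < q) (hF : 0 < F) (ht : 0 ≤ t) :
    0 ≤ mpConv (fun t => t) (stair q F) t := by
  apply le_mpConv_aux ht
  intro s hs hst
  have := stair_nonneg_aux hq hF hs
  linarith

lemma gabs_nonneg {q δ S D x : ℝ} (hq : 0 < q) (hδ : δ < q) (hS : 0 < S) :
    0 ≤ gabs q δ S D x := by
  unfold gabs
  have h1 : 0 ≤ pospart (x - (q - δ + S + D)) := le_max_right _ _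
  have h2 : 0 ≤ pospart (x - D) := le_max_right _ _
  have h3 := mpConv_nonneg_aux hq (by linarith : 0 < q + S) h1
  have h4 : 0 ≤ min (pospart (x - D)) (q - δ) := le_min h2 (by linarith)
  linarith

lemma gabs_lower {q δ S D x y : ℝ} (hq : 0 < q) (hδ : δ < q) (hS : 0 < S)
    (hy : 0 < y) (m : ℤ) (hm : 0 ≤ m) (hmy : m * q - δ < y) (hx : y ≤ gabs q δ S D x) :
    y + D + m * S ≤ x := by
  unfold gabs at hx
  have hF : 0 < q + S := by linarith
  have ht : 0 ≤ pospart (x - (q - δ + S + D)) := le_max_right _ _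
  have hle := min_le_right (pospart (x - D)) (q - δ)
  have hle2 := min_le_left (pospart (x - D)) (q - δ)
  have h0 := mpConv_le_aux_s3 hq hF le_rfl ht
  have hst0 : stair q (q + S) 0 = 0 := by simp [stair]
  rw [hst0] at h0
  rcases hm.eq_or_lt with rfl | hm
  · rcases le_total (x - (q - δ + S + D)) 0 with h | h
    · have e : pospart (x - (q - δ + S + D)) = 0 := max_eq_right h
      rw [e] at hx h0
      rcases le_total (x - D) 0 with h' | h'
      · have e' : pospart (x - D) = 0 := max_eq_right h'
        linarith
      · have e' : pospart (x - D) = x - D := max_eq_left h'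
        push_cast
        linarith
    · have e : pospart (x - (q - δ + S + D)) = x - (q - δ + S + D) := max_eq_left h
      rw [e] at hx h0
      push_cast
      linarith
  · have hm1 : (1 : ℝ) ≤ m := by exact_mod_cast hm
    set t := pospart (x - (q - δ + S + D)) with htdef
    rcases lt_or_ge t ((m - 1 : ℝ) * (q + S)) with h | h
    · exfalso
      have h1 := mpConv_le_aux_s3 hq hF ht le_rfl
      have h2 : ⌈t / (q + S)⌉ ≤ m - 1 := by
        rw [Int.ceil_le, div_le_iff₀ hF]
        push_cast
        exact h.le
      have h3 : (⌈t / (q + S)⌉ : ℝ) ≤ m - 1 := by exact_mod_cast h2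
      have h4 : stair q (q + S) t ≤ q * (m - 1) := by
        unfold stair
        exact mul_le_mul_of_nonneg_left h3 hq.le
      nlinarith
    · have h1 := mpConv_le_aux_s3 hq hF (by nlinarith : 0 ≤ (m - 1 : ℝ) * (q + S)) h
      have h2 : stair q (q + S) ((m - 1 : ℝ) * (q + S)) = q * (m - 1) := by
        unfold stair
        rw [mul_div_cancel_right₀ _ hF.ne']
        have : ((m : ℝ) - 1) = ((m - 1 : ℤ) : ℝ) := by push_cast; rfl
        rw [this, Int.ceil_intCast]
      rw [h2] at h1
      have h5 : 0 < t := by nlinarith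
      have h6 : t = x - (q - δ + S + D) := by
        rcases le_total (x - (q - δ + S + D)) 0 with h | h
        · have e : pospart (x - (q - δ + S + D)) = 0 := max_eq_right h
          linarith
        · exact max_eq_left h
      nlinarith

lemma gabs_upper {q δ S D x y : ℝ} (hq : 0 < q) (hδ : δ < q) (hS : 0 < S)
    (hy : 0 < y) (m : ℤ) (hm : 0 ≤ m) (hmy : m * q - δ ≤ y) (hmy2 : y ≤ (m + 1) * q - δ)
    (hx : y + D + m * S ≤ x) : y ≤ gabs q δ S D x := by
  unfold gabs
  have hF : 0 < q + S := by linarith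
  have ht : 0 ≤ pospart (x - (q - δ + S + D)) := le_max_right _ _
  have hxt : x - (q - δ + S + D) ≤ pospart (x - (q - δ + S + D)) := le_max_left _ _
  have hxD : x - D ≤ pospart (x - D) := le_max_left _ _
  rcases hm.eq_or_lt with rfl | hm
  · have h1 := mpConv_nonneg_aux hq hF ht
    push_cast at *
    have h2 : y ≤ min (pospart (x - D)) (q - δ) := le_min (by linarith) (by linarith)
    linarith
  · have hm1 : (1 : ℝ) ≤ m := by exact_mod_cast hm
    have h2 : q - δ ≤ min (pospart (x - D)) (q - δ) := le_min (by nlinarith) le_rfl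
    suffices h : y - (q - δ) ≤ mpConv (fun t => t) (stair q (q + S))
        (pospart (x - (q - δ + S + D))) by linarith
    apply le_mpConv_aux ht
    intro s hs hst
    set k := ⌈s / (q + S)⌉ with hk
    have hsk : s ≤ k * (q + S) := by
      rw [← div_le_iff₀ hF]
      exact Int.le_ceil _
    have e : stair q (q + S) s = q * k := rfl
    rw [e]
    rcases le_or_gt k (m - 1) with h | h
    · have h' : (k : ℝ) ≤ m - 1 := by exact_mod_cast h
      nlinarith
    · have h' : (m : ℝ) ≤ k := by exact_mod_cast (by omega : m ≤ k)
      nlinarith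

/-- Abstract psi. -/
noncomputable def pabs (q δ S D x : ℝ) : ℝ := x + (⌊(x + δ) / q⌋ : ℝ) * S + D

lemma key_upper {q δ S D c r b τ M t : ℝ} (hq : 0 < q) (hδ0 : 0 ≤ δ) (hδ : δ < q) (hS : 0 < S)
    (hc : 0 < c) (hr : 0 < r) (hb : 0 < b) (hrate : r * (q + S) ≤ q * c)
    (hτ : r * τ = q * (⌊(b + δ) / q⌋ + 1) - (b + δ))
    (hM1 : pabs q δ S D b ≤ c * M) (hM2 : pabs q δ S D (r * τ + b) ≤ c * (M + τ)) (ht : 0 < t) :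
    r * t + b ≤ gabs q δ S D (c * (t + M)) := by
  have hrc : r ≤ c := by nlinarith
  set y := r * t + b with hy
  have hrt : 0 < r * t := by positivity
  have hy0 : 0 < y := by linarith
  set k := ⌊(b + δ) / q⌋ with hk
  set m := ⌈(y + δ) / q⌉ - 1 with hm
  have hmR : (m : ℝ) = (⌈(y + δ) / q⌉ : ℝ) - 1 := by rw [hm]; push_cast; rfl
  have h1 : y + δ ≤ (m + 1) * q := by
    rw [← div_le_iff₀ hq, hmR]
    have := Int.le_ceil ((y + δ) / q)
    linarith
  have h2 : m * q < y + δ := by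
    rw [← lt_div_iff₀ hq, hmR]
    have := Int.ceil_lt_add_one ((y + δ) / q)
    linarith
  have hm0 : 0 ≤ m := by
    have : 0 < ⌈(y + δ) / q⌉ := Int.ceil_pos.2 (by positivity)
    omega
  refine gabs_upper hq hδ hS hy0 m hm0 (by linarith) (by linarith) ?_
  rcases le_or_gt m k with h | h
  · have h' : (m : ℝ) ≤ k := by exact_mod_cast h
    unfold pabs at hM1
    rw [← hk] at hM1
    nlinarith
  · have h' : (k : ℝ) + 1 ≤ m := by exact_mod_cast h
    unfold pabs at hM2
    have e : (r * τ + b + δ) / q = ((k + 1 : ℤ) : ℝ) := by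
      rw [div_eq_iff hq.ne']; push_cast; linarith
    rw [e, Int.floor_intCast] at hM2
    push_cast at hM2
    have h3 : ((m : ℝ) - k - 1) * q ≤ r * (t - τ) := by linarith
    have hp : 0 ≤ (m : ℝ) - k - 1 := by linarith
    have h4 : ((m : ℝ) - k - 1) * S ≤ (c - r) * (t - τ) := by
      have h5 : r * (((m : ℝ) - k - 1) * S) ≤ r * ((c - r) * (t - τ)) := by
        have a1 := mul_le_mul_of_nonneg_left h3 (sub_nonneg.2 hrc)
        have a2 := mul_le_mul_of_nonneg_left hrate hp
        linarith
      exact le_of_mul_le_mul_left h5 hr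
    linarith

lemma key_lower {q δ S D c r t0 y0 η u : ℝ} (hq : 0 < q) (hδ0 : 0 ≤ δ) (hδ : δ < q) (hS : 0 < S)
    (hD : 0 ≤ D) (hc : 0 < c) (hr : 0 < r) (hy0 : 0 < y0) (hη : 0 < η)
    (hu : r * η + y0 ≤ gabs q δ S D (c * pospart u)) :
    pabs q δ S D y0 / c ≤ u := by
  have hk : 0 ≤ ⌊(y0 + δ) / q⌋ := Int.floor_nonneg.2 (by positivity)
  have hrη : 0 < r * η := by positivity
  have h1 : (⌊(y0 + δ) / q⌋ : ℝ) * q ≤ y0 + δ := by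
    rw [← le_div_iff₀ hq]; exact Int.floor_le _
  have h := gabs_lower hq hδ hS (by linarith) _ hk (by linarith) hu
  have hkR : (0 : ℝ) ≤ ⌊(y0 + δ) / q⌋ := by exact_mod_cast hk
  have hp : 0 < pabs q δ S D y0 := by unfold pabs; positivity
  have h2 : pabs q δ S D y0 ≤ c * pospart u := by unfold pabs; linarith
  rw [div_le_iff₀ hc]
  rcases le_total u 0 with h' | h'
  · have e : pospart u = 0 := max_eq_right h'
    rw [e] at h2; linarith
  · have e : pospart u = u := max_eq_left h'
    rw [e] at h2; linarith

lemma abstract_main {q δ S D c T r b τ : ℝ} (hq : 0 < q) (hδ0 : 0 ≤ δ) (hδ : δ < q) (hS : 0 < S)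
    (hD : 0 ≤ D) (hc : 0 < c) (hT : 0 ≤ T) (hr : 0 < r) (hb : 0 < b) 
    (hrate : r * (q + S) ≤ q * c)
    (α : ℝ → ℝ) (hα0 : α 0 = 0) (hαpos : ∀ t : ℝ, 0 < t → α t = r * t + b)
    (hτ : r * τ = q * (⌊(b + δ) / q⌋ + 1) - (b + δ)) :
    hDev α (fun t => gabs q δ S D (c * pospart (t - T)))
      = T + max (pabs q δ S D b / c) (pabs q δ S D (α τ) / c - τ) := by
  have hτ0 : 0 < τ := by
    have h := Int.lt_floor_add_one ((b + δ) / q)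
    rw [div_lt_iff₀ hq] at h
    have : 0 < r * τ := by linarith
    exact (mul_pos_iff_of_pos_left hr).1 this
  rw [hαpos τ hτ0]
  set M := max (pabs q δ S D b / c) (pabs q δ S D (r * τ + b) / c - τ) with hM
  have hM1 : pabs q δ S D b ≤ c * M := by
    have := le_max_left (pabs q δ S D b / c) (pabs q δ S D (r * τ + b) / c - τ)
    rw [← hM, div_le_iff₀ hc] at this
    linarith
  have hM2 : pabs q δ S D (r * τ + b) ≤ c * (M + τ) := by
    have := le_max_right (pabs q δ S D b / c) (pabs q δ S D (r * τ + b) / c - τ)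
    rw [← hM, sub_le_iff_le_add, div_le_iff₀ hc] at this
    linarith
  have hM0 : 0 < M := by
    have hk : (0 : ℝ) ≤ ⌊(b + δ) / q⌋ := by
      exact_mod_cast Int.floor_nonneg.2 (by positivity)
    have : 0 < pabs q δ S D b := by unfold pabs; positivity
    exact (mul_pos_iff_of_pos_left hc).1 (by linarith)
  have hmem : ∀ t, 0 ≤ t → (T + M) ∈
      {e : ℝ | 0 ≤ e ∧ α t ≤ gabs q δ S D (c * pospart (t + e - T))} := by
    intro t ht
    refine ⟨by linarith, ?_⟩
    have e : pospart (t + (T + M) - T) = t + M := by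
      unfold pospart
      rw [max_eq_left (by linarith)]; ring
    rw [e]
    rcases ht.eq_or_lt with rfl | ht
    · rw [hα0]; exact gabs_nonneg hq hδ hS
    · rw [hαpos t ht]
      exact key_upper hq hδ0 hδ hS hc hr hb hrate hτ hM1 hM2 ht
  have hub : ∀ z ∈ {z : ℝ | ∃ t : ℝ, 0 ≤ t ∧ z = sInf {e : ℝ | 0 ≤ e ∧ α t ≤
      gabs q δ S D (c * pospart (t + e - T))}}, z ≤ T + M := by
    rintro z ⟨t, ht, rfl⟩
    exact csInf_le ⟨0, fun e he => he.1⟩ (hmem t ht)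
  have hlb : ∀ t0, 0 ≤ t0 → T + (pabs q δ S D (r * t0 + b) / c - t0) ≤
      sSup {z : ℝ | ∃ t : ℝ, 0 ≤ t ∧ z = sInf {e : ℝ | 0 ≤ e ∧ α t ≤
      gabs q δ S D (c * pospart (t + e - T))}} := by
    intro t0 ht0
    apply le_of_forall_pos_le_add
    intro η hη
    have h1 : T + (pabs q δ S D (r * t0 + b) / c - t0) - η ≤
        sInf {e : ℝ | 0 ≤ e ∧ α (t0 + η) ≤ gabs q δ S D (c * pospart (t0 + η + e - T))} := by
      apply le_csInf ⟨_, hmem (t0 + η) (by linarith)⟩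
      rintro e ⟨he0, he⟩
      rw [hαpos _ (by linarith)] at he
      have hy0 : 0 < r * t0 + b := by positivity
      have := key_lower (t0 := t0) (y0 := r * t0 + b) (η := η) (u := t0 + η + e - T)
        hq hδ0 hδ hS hD hc hr hy0 hη (by
          refine le_trans (le_of_eq ?_) he
          ring)
      linarith
    have h2 := le_csSup ⟨T + M, hub⟩ (⟨t0 + η, by linarith, rfl⟩ :
      sInf {e : ℝ | 0 ≤ e ∧ α (t0 + η) ≤ gabs q δ S D (c * pospart (t0 + η + e - T))} ∈ 
      {z : ℝ | ∃ t : ℝ, 0 ≤ t ∧ z = sInf {e : ℝ | 0 ≤ e ∧ α t ≤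
      gabs q δ S D (c * pospart (t + e - T))}})
    linarith
  unfold hDev
  apply le_antisymm
  · exact csSup_le ⟨_, 0, le_rfl, rfl⟩ hub
  · have h0 := hlb 0 le_rfl
    have h1 := hlb τ hτ0.le
    simp only [mul_zero, zero_add, sub_zero] at h0
    rcases max_choice (pabs q δ S D b / c) (pabs q δ S D (r * τ + b) / c - τ) with h | h
    · rw [hM, h]; exact h0
    · rw [hM, h]; exact h1

lemma psi_eq_pabs {n : ℕ} (Q d : Fin n → ℝ) (i : Fin n) (x : ℝ) :
    psi Q d i x = pabs (Q i) (d i) (∑ j ∈ Finset.univ.erase i, Q j)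
      (∑ j ∈ Finset.univ.erase i, (Q j + d j)) x := by
  unfold psi pabs phi
  rw [Finset.mul_sum, add_assoc, ← Finset.sum_add_distrib]
  congr 1
  apply Finset.sum_congr rfl
  intros
  ring

theorem delay_bound_token_bucket {n : ℕ} (hn : 2 ≤ n) (Q d : Fin n → ℝ)
    (hQ : ∀ j, 0 < Q j) (hd : ∀ j, 0 ≤ d j ∧ d j < Q j) (i : Fin n)
    (c T r b : ℝ) (hc : 0 < c) (hT : 0 ≤ T) (hr : 0 < r) (hb : 0 < b)
    (hrate : r ≤ Q i / (∑ j, Q j) * c)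
    (α : ℝ → ℝ) (hα0 : α 0 = 0) (hαpos : ∀ t : ℝ, 0 < t → α t = r * t + b)
    (τ : ℝ) (hτ : τ = (Q i - rmod (b + d i) (Q i)) / r) :
    hDev α (fun t => gam Q d i (c * pospart (t - T)))
      = T + max (psi Q d i b / c) (psi Q d i (α τ) / c - τ) := by
  have htot : ∑ j, Q j = Q i + ∑ j ∈ Finset.univ.erase i, Q j :=
    (Finset.add_sum_erase _ _ (Finset.mem_univ i)).symm
  have hS : 0 < ∑ j ∈ Finset.univ.erase i, Q j := by
    apply Finset.sum_pos (fun j _ => hQ j)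
    rw [← Finset.card_pos, Finset.card_erase_of_mem (Finset.mem_univ i)]
    simp
    omega
  have hD : 0 ≤ ∑ j ∈ Finset.univ.erase i, (Q j + d j) :=
    Finset.sum_nonneg (fun j _ => by have := hQ j; have := (hd j).1; linarith)
  have hq := hQ i
  have hg : ∀ x, gam Q d i x = gabs (Q i) (d i) (∑ j ∈ Finset.univ.erase i, Q j)
      (∑ j ∈ Finset.univ.erase i, (Q j + d j)) x := by
    intro x
    unfold gam gabs
    rw [psi_eq_pabs, htot]
    unfold pabs
    rw [sub_add_cancel, div_self hq.ne', Int.floor_one]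
    simp
  simp only [hg, psi_eq_pabs]
  apply abstract_main hq (hd i).1 (hd i).2 hS hD hc hT hr hb _ α hα0 hαpos
  · rw [hτ]
    unfold rmod
    field_simp
    ring
  · rw [htot, div_mul_eq_mul_div, le_div_iff₀ (by linarith)] at hrate
    exact hrate
end

section
/- (Corollary 1, max-rate rate-latency lower bound.) Let R_max = Q_i/Q_tot and T_max = Σ_{j≠i}( (Q_j/Q_i)·d_i + Q_j + d_j ). Then for all x ≥ 0, R_max·[x − T_max]^+ ≤ γ_i(x). -/
open Finset Set

theorem conv_lower (a b y : ℝ) (ha : 0 ≤ a) (hb : 0 < b) (hab : a ≤ b) (hy : 0 ≤ y) :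
    a / b * y ≤ mpConv (fun t => t) (stair a b) y := by
  unfold mpConv
  apply le_csInf
  · exact ⟨_, ⟨0, ⟨le_refl _, hy⟩, rfl⟩⟩
  · rintro _ ⟨s, ⟨hs0, hsy⟩, rfl⟩
    simp only [stair]
    have h1 : a * (s / b) ≤ a * (Int.ceil (s / b) : ℝ) :=
      mul_le_mul_of_nonneg_left (Int.le_ceil _) ha
    have h2 : a * (s / b) = a / b * s := by ring
    have h3 : a / b ≤ 1 := (div_le_one hb).2 hab
    nlinarith [mul_nonneg (sub_nonneg.2 h3) (sub_nonneg.2 hsy)]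

theorem max_rate_rate_latency_lower_bound {n : ℕ} (hn : 2 ≤ n) (Q d : Fin n → ℝ)
    (hQ : ∀ j, 0 < Q j) (hd : ∀ j, 0 ≤ d j ∧ d j < Q j) (i : Fin n) :
    ∀ x : ℝ, 0 ≤ x →
      Q i / (∑ j, Q j) *
          pospart (x - ∑ j ∈ Finset.univ.erase i, (Q j / Q i * d i + Q j + d j))
        ≤ gam Q d i x := by
  intro x hx
  have hq := hQ i
  obtain ⟨hd0, hd1⟩ := hd i
  have hS0 : 0 ≤ ∑ j ∈ Finset.univ.erase i, Q j := Finset.sum_nonneg fun j _ => (hQ j).le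
  have htot : ∑ j, Q j = Q i + ∑ j ∈ Finset.univ.erase i, Q j :=
    (Finset.add_sum_erase _ _ (Finset.mem_univ i)).symm
  have hpsi : psi Q d i (Q i - d i) = Q i - d i + (∑ j ∈ Finset.univ.erase i, Q j)
      + ∑ j ∈ Finset.univ.erase i, (Q j + d j) := by
    simp only [psi, phi, sub_add_cancel, div_self hq.ne', Int.floor_one, Int.cast_one, one_mul,
      Finset.sum_add_distrib]
    ring
  have hT : ∑ j ∈ Finset.univ.erase i, (Q j / Q i * d i + Q j + d j)
      = (∑ j ∈ Finset.univ.erase i, Q j) / Q i * d i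
        + ∑ j ∈ Finset.univ.erase i, (Q j + d j) := by
    simp only [Finset.sum_add_distrib, Finset.sum_div, Finset.sum_mul]
    ring
  unfold gam
  rw [hpsi, hT, htot]
  generalize (∑ j ∈ Finset.univ.erase i, Q j) = S at *
  generalize (∑ j ∈ Finset.univ.erase i, (Q j + d j)) = L at *
  generalize Q i = q at *
  generalize d i = e at *
  have hb : 0 < q + S := by linarith
  have hc := conv_lower q (q + S) (pospart (x - (q - e + S + L))) hq.le hb (by linarith)
    (le_max_right _ _)
  have hR0 : 0 ≤ q / (q + S) := by positivity
  have hR1 : q / (q + S) ≤ 1 := (div_le_one hb).2 (by linarith)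
  have key : q / (q + S) * (q - e + S - S / q * e) = q - e := by
    field_simp
    ring
  have hU : 0 ≤ S / q * e := by positivity
  refine le_trans ?_ (add_le_add_left hc _)
  generalize q / (q + S) = R at *
  generalize S / q * e = U at *
  unfold pospart
  rcases le_total (x - (U + L)) 0 with h | h
  · rw [max_eq_right h, mul_zero]
    have : 0 ≤ R * max (x - (q - e + S + L)) 0 := mul_nonneg hR0 (le_max_right _ _)
    have : 0 ≤ min (max (x - L) 0) (q - e) := le_min (le_max_right _ _) (by linarith)
    linarith
  · rw [max_eq_left h]
    rw [← sub_le_iff_le_add']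
    apply le_min
    · refine le_trans ?_ (le_max_left _ _)
      have : 0 ≤ R * max (x - (q - e + S + L)) 0 := mul_nonneg hR0 (le_max_right _ _)
      nlinarith
    · have := mul_le_mul_of_nonneg_left (le_max_left (x - (q - e + S + L)) 0) hR0
      nlinarith
end

section
/- (Corollary 2, convex closure of γ_i.) Let R_max = Q_i/Q_tot, T_max = Σ_{j≠i}((Q_j/Q_i)·d_i + Q_j + d_j), R_min = (Q_i − d_i)/(Q_tot − d_i), T_min = Σ_{j≠i}(Q_j + d_j), and define γ_i^convex(x) = max( R_max·[x − T_max]^+ , R_min·[x − T_min]^+ ). Then γ_i^convex(x) ≤ γ_i(x) for all x ≥ 0, and γ_i^convex is the largest convex lower bound of γ_i: every convex function h : ℝ≥0 → ℝ with h(x) ≤ γ_i(x) for all x ≥ 0 satisfies h(x) ≤ γ_i^convex(x) for all x ≥ 0. -/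
open Finset Set

lemma chord_aux (h : ℝ → ℝ) (hc : ConvexOn ℝ (Set.Ici 0) h) (m c a b x : ℝ) (ha : 0 ≤ a)
    (hax : a ≤ x) (hxb : x ≤ b) (h1 : h a ≤ m * a + c) (h2 : h b ≤ m * b + c) :
    h x ≤ m * x + c := by
  have hb : 0 ≤ b := by linarith
  rcases eq_or_lt_of_le (hax.trans hxb) with hab | hab
  · have : x = a := by linarith
    rw [this]; exact h1
  · have hba : 0 < b - a := by linarith
    have w1 : 0 ≤ (b - x) / (b - a) := div_nonneg (by linarith) hba.le
    have w2 : 0 ≤ (x - a) / (b - a) := div_nonneg (by linarith) hba.le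
    have w3 : (b - x) / (b - a) + (x - a) / (b - a) = 1 := by field_simp; ring
    have key := hc.2 (Set.mem_Ici.2 ha) (Set.mem_Ici.2 hb) w1 w2 w3
    simp only [smul_eq_mul] at key
    have e : (b - x) / (b - a) * a + (x - a) / (b - a) * b = x := by field_simp; ring
    rw [e] at key
    have u1 := mul_le_mul_of_nonneg_left h1 (div_nonneg (by linarith : 0 ≤ b - x) hba.le)
    have u2 := mul_le_mul_of_nonneg_left h2 (div_nonneg (by linarith : 0 ≤ x - a) hba.le)
    have e2 : (b - x) / (b - a) * (m * a + c) + (x - a) / (b - a) * (m * b + c) = m * x + c := by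
      field_simp; ring
    linarith

lemma conv_lower_s11 (A T t : ℝ) (hA : 0 < A) (hAT : A ≤ T) (ht : 0 ≤ t) :
    A / T * t ≤ mpConv (fun t => t) (stair A T) t := by
  have hT : 0 < T := by linarith
  unfold mpConv stair
  apply le_csInf
  · exact ⟨_, Set.mem_image_of_mem _ (Set.left_mem_Icc.2 ht)⟩
  · rintro _ ⟨s, ⟨hs0, hst⟩, rfl⟩
    have h1 : A * (s / T) ≤ A * (Int.ceil (s / T) : ℝ) :=
      mul_le_mul_of_nonneg_left (Int.le_ceil _) hA.le
    have h2 : A / T ≤ 1 := (div_le_one hT).2 hAT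
    have h3 : A * (s / T) = A / T * s := by ring
    simp only
    nlinarith

lemma conv_upper (A T : ℝ) (hA : 0 < A) (hT : 0 < T) (k : ℕ) :
    mpConv (fun t => t) (stair A T) (k * T) ≤ A * k := by
  unfold mpConv stair
  apply csInf_le
  · refine ⟨0, ?_⟩
    rintro _ ⟨s, ⟨hs0, hst⟩, rfl⟩
    have h1 : A * (s / T) ≤ A * (Int.ceil (s / T) : ℝ) :=
      mul_le_mul_of_nonneg_left (Int.le_ceil _) hA.le
    have : 0 ≤ A * (s / T) := by positivity
    simp only
    linarith
  · refine ⟨k * T, ⟨by positivity, le_refl _⟩, ?_⟩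
    have : (k : ℝ) * T / T = k := by field_simp
    simp [this]

theorem convex_closure_of_gam {n : ℕ} (hn : 2 ≤ n) (Q d : Fin n → ℝ)
    (hQ : ∀ j, 0 < Q j) (hd : ∀ j, 0 ≤ d j ∧ d j < Q j) (i : Fin n) :
    (∀ x : ℝ, 0 ≤ x →
      max (Q i / (∑ j, Q j) *
            pospart (x - ∑ j ∈ Finset.univ.erase i, (Q j / Q i * d i + Q j + d j)))
          ((Q i - d i) / ((∑ j, Q j) - d i) *
            pospart (x - ∑ j ∈ Finset.univ.erase i, (Q j + d j)))
        ≤ gam Q d i x) ∧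
    (∀ h : ℝ → ℝ, ConvexOn ℝ (Set.Ici 0) h → (∀ x : ℝ, 0 ≤ x → h x ≤ gam Q d i x) →
      ∀ x : ℝ, 0 ≤ x →
        h x ≤ max (Q i / (∑ j, Q j) *
            pospart (x - ∑ j ∈ Finset.univ.erase i, (Q j / Q i * d i + Q j + d j)))
          ((Q i - d i) / ((∑ j, Q j) - d i) *
            pospart (x - ∑ j ∈ Finset.univ.erase i, (Q j + d j)))) := by
  have hA := hQ i
  obtain ⟨hd0, hdA⟩ := hd i
  obtain ⟨B, hB⟩ : ∃ B, B = ∑ j ∈ Finset.univ.erase i, Q j := ⟨_, rfl⟩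
  obtain ⟨P, hP⟩ : ∃ P, P = ∑ j ∈ Finset.univ.erase i, (Q j + d j) := ⟨_, rfl⟩
  have hB0 : 0 ≤ B := hB ▸ Finset.sum_nonneg (fun j _ => (hQ j).le)
  have hP0 : 0 ≤ P := hP ▸ Finset.sum_nonneg (fun j _ => add_nonneg (hQ j).le (hd j).1)
  have hT : ∑ j, Q j = Q i + B := by
    rw [hB, Finset.add_sum_erase _ _ (Finset.mem_univ i)]
  have hmax : ∑ j ∈ Finset.univ.erase i, (Q j / Q i * d i + Q j + d j) = B * d i / Q i + P := by
    rw [hB, hP, Finset.sum_mul, Finset.sum_div, ← Finset.sum_add_distrib]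
    exact Finset.sum_congr rfl (fun j _ => by ring)
  have hpsi : psi Q d i (Q i - d i) = (Q i - d i) + B + P := by
    unfold psi phi
    have : (Q i - d i + d i) / Q i = 1 := by rw [sub_add_cancel]; exact div_self hA.ne'
    rw [this, hB, hP, add_assoc, ← Finset.sum_add_distrib]
    congr 1
    exact Finset.sum_congr rfl (fun j _ => by simp; ring)
  have hgam : ∀ x, gam Q d i x = mpConv (fun t => t) (stair (Q i) (Q i + B))
      (pospart (x - ((Q i - d i) + B + P))) + min (pospart (x - P)) (Q i - d i) := by
    intro x
    unfold gam
    rw [hpsi, hT, hP]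
  simp only [hgam]
  rw [hT, hmax, ← hP]
  clear hgam hpsi hmax hT hP hB
  generalize Q i = A at *
  generalize d i = e at *
  clear hQ hd hn
  have hq : 0 < A - e := by linarith
  have hTp : 0 < A + B := by linarith
  have hqB : 0 < A + B - e := by linarith
  obtain ⟨R, hR⟩ : ∃ R, R = A / (A + B) := ⟨_, rfl⟩
  obtain ⟨r, hr⟩ : ∃ r, r = (A - e) / (A + B - e) := ⟨_, rfl⟩
  have hR1 : R ≤ 1 := by rw [hR, div_le_one hTp]; linarith
  have hr1 : r ≤ 1 := by rw [hr, div_le_one hqB]; linarith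
  have hR0 : 0 < R := hR ▸ div_pos hA hTp
  have hr0 : 0 < r := hr ▸ div_pos hq hqB
  have hrR : r ≤ R := by
    rw [hr, hR, div_le_div_iff₀ hqB hTp]; nlinarith
  have hRT : R * (A + B) = A := by rw [hR]; field_simp
  have hrq : r * (A + B - e) = A - e := by rw [hr]; field_simp
  -- value of the steep line at the first corner
  have hRc : R * ((A - e) + B - B * e / A) = A - e := by
    rw [hR]; field_simp; ring
  have hBe : 0 ≤ B * e / A := by positivity
  rw [← hR, ← hr]
  constructor
  · intro x hx
    have hlow := conv_lower_s11 A (A + B) (pospart (x - (A - e + B + P))) hA (by linarith)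
      (le_max_right _ _)
    rw [← hR] at hlow
    obtain ⟨C, hC⟩ : ∃ C, C = mpConv (fun t => t) (stair A (A + B))
      (pospart (x - (A - e + B + P))) := ⟨_, rfl⟩
    rw [← hC] at hlow ⊢
    clear hC
    have hC0 : 0 ≤ C := le_trans (mul_nonneg hR0.le (le_max_right _ _)) hlow
    have hC1 : R * (x - (A - e + B + P)) ≤ C :=
      le_trans (mul_le_mul_of_nonneg_left (le_max_left _ _) hR0.le) hlow
    have hnn : 0 ≤ C + min (pospart (x - P)) (A - e) :=
      add_nonneg hC0 (le_min (le_max_right _ _) hq.le)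
    have red : ∀ a m : ℝ, (m * a ≤ C + min (pospart (x - P)) (A - e)) →
        m * pospart a ≤ C + min (pospart (x - P)) (A - e) := by
      intro a m hh
      unfold pospart at *
      rcases max_choice a 0 with h' | h' <;> rw [h']
      · exact hh
      · simpa using hnn
    have main : ∀ v : ℝ, (v ≤ 0 ∨ v ≤ C + (x - P)) → (v ≤ C + (A - e)) →
        v ≤ C + min (pospart (x - P)) (A - e) := by
      intro v h1 h2
      rw [← min_add_add_left]
      refine le_min ?_ h2
      rcases h1 with h1 | h1
      · exact h1.trans (add_nonneg hC0 (le_max_right _ _))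
      · exact h1.trans (by unfold pospart; gcongr; exact le_max_left _ _)
    refine max_le (red _ _ (main _ ?_ ?_)) (red _ _ (main _ ?_ ?_))
    · rcases le_total (x - P) 0 with h | h
      · left; nlinarith
      · right; nlinarith
    · nlinarith
    · rcases le_total (x - P) 0 with h | h
      · left; nlinarith
      · right; nlinarith
    · rcases le_total (x - P) (A - e + B) with h | h
      · nlinarith
      · nlinarith
  · intro h hc hle x hx
    have h0 : ∀ x, 0 ≤ x → x ≤ P → h x ≤ 0 := by
      intro x hx hxP
      have h1 := hle x hx
      have e1 : pospart (x - (A - e + B + P)) = ((0 : ℕ) : ℝ) * (A + B) := by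
        unfold pospart; rw [max_eq_right (by linarith)]; simp
      have e2 : pospart (x - P) = 0 := max_eq_right (by linarith)
      have h2 := conv_upper A (A + B) hA hTp 0
      rw [e1, e2, min_eq_left hq.le] at h1
      simp at h1 h2
      linarith
    have hk : ∀ k : ℕ, h (A - e + B + P + k * (A + B)) ≤ A * k + (A - e) := by
      intro k
      have hkk : 0 ≤ (k : ℝ) * (A + B) := by positivity
      have h1 := hle (A - e + B + P + k * (A + B)) (by linarith)
      have e1 : pospart (A - e + B + P + k * (A + B) - (A - e + B + P)) = k * (A + B) := by
        unfold pospart; rw [add_sub_cancel_left]; exact max_eq_left hkk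
      rw [e1] at h1
      have h2 := conv_upper A (A + B) hA hTp k
      have h3 := min_le_right (pospart (A - e + B + P + k * (A + B) - P)) (A - e)
      linarith
    rcases le_total x P with hxP | hxP
    · exact (h0 x hx hxP).trans
        (le_max_of_le_left (mul_nonneg hR0.le (le_max_right _ _)))
    rcases le_total x (A - e + B + P) with hx1 | hx1
    · apply le_max_of_le_right
      have hk0 := hk 0
      simp only [Nat.cast_zero, zero_mul, add_zero, mul_zero, zero_add] at hk0
      have := chord_aux h hc r (-(r * P)) P (A - e + B + P) x hP0 hxP hx1
        (by have := h0 P hP0 le_rfl; linarith) (by linarith)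
      refine le_trans ?_ (mul_le_mul_of_nonneg_left (le_max_left _ _) hr0.le)
      linarith
    · apply le_max_of_le_left
      obtain ⟨k, hk'⟩ : ∃ k : ℕ, k = ⌊(x - (A - e + B + P)) / (A + B)⌋₊ := ⟨_, rfl⟩
      have hlo : (k : ℝ) * (A + B) ≤ x - (A - e + B + P) := by
        rw [← le_div_iff₀ hTp, hk']
        exact Nat.floor_le (div_nonneg (by linarith) hTp.le)
      have hhi : x - (A - e + B + P) ≤ ((k + 1 : ℕ) : ℝ) * (A + B) := by
        rw [← div_le_iff₀ hTp, hk']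
        push_cast
        exact (Nat.lt_floor_add_one _).le
      have hval : ∀ k : ℕ, h (A - e + B + P + k * (A + B)) ≤
          R * (A - e + B + P + k * (A + B)) + (-(R * (B * e / A + P))) := by
        intro k
        have h1 := hk k
        have h2 : R * (k * (A + B)) = A * k := by
          calc R * (k * (A + B)) = (R * (A + B)) * k := by ring
            _ = A * k := by rw [hRT]
        linarith
      have hkk : 0 ≤ (k : ℝ) * (A + B) := by positivity
      have := chord_aux h hc R (-(R * (B * e / A + P))) _ _ x (by linarith)
        (by linarith) (by linarith) (hval k) (hval (k + 1))
      refine le_trans ?_ (mul_le_mul_of_nonneg_left (le_max_left _ _) hR0.le)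
      linarith
end

section
/- (Concave closure of the interference function φ_{i,j}.) Fix j ≠ i and define φ_{i,j}^maxRate(x) = (Q_j/Q_i)·(x + d_i) + Q_j + d_j and φ_{i,j}^minLatency(x) = (Q_j/(Q_i − d_i))·x + Q_j + d_j. Then φ_{i,j}^concave(x) = min(φ_{i,j}^maxRate(x), φ_{i,j}^minLatency(x)) is the smallest concave upper bound of φ_{i,j} on ℝ≥0: φ_{i,j}(x) ≤ φ_{i,j}^concave(x) for all x ≥ 0, and every concave function h : ℝ≥0 → ℝ with h(x) ≥ φ_{i,j}(x) for all x ≥ 0 satisfies h(x) ≥ φ_{i,j}^concave(x) for all x ≥ 0. -/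
open Finset Set

theorem concave_closure_of_phi {n : ℕ} (hn : 2 ≤ n) (Q d : Fin n → ℝ)
    (hQ : ∀ j, 0 < Q j) (hd : ∀ j, 0 ≤ d j ∧ d j < Q j) (i : Fin n)
    (j : Fin n) (hj : j ≠ i) :
    (∀ x : ℝ, 0 ≤ x →
      phi Q d i j x
        ≤ min (Q j / Q i * (x + d i) + Q j + d j)
            (Q j / (Q i - d i) * x + Q j + d j)) ∧
    (∀ h : ℝ → ℝ, ConcaveOn ℝ (Set.Ici 0) h →
      (∀ x : ℝ, 0 ≤ x → phi Q d i j x ≤ h x) →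
      ∀ x : ℝ, 0 ≤ x →
        min (Q j / Q i * (x + d i) + Q j + d j)
            (Q j / (Q i - d i) * x + Q j + d j) ≤ h x) := by
  have hQi := hQ i
  have hQj := hQ j
  obtain ⟨hd0, hdQ⟩ := hd i
  have hpos : 0 < Q i - d i := by linarith
  refine ⟨fun x hx => ?_, fun h hc hh x hx => ?_⟩
  · have hfl : (Int.floor ((x + d i) / Q i) : ℝ) ≤ (x + d i) / Q i := Int.floor_le _
    unfold phi
    refine le_min ?_ ?_
    · have h1 := mul_le_mul_of_nonneg_right hfl hQj.le
      have h2 : (x + d i) / Q i * Q j = Q j / Q i * (x + d i) := by ring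
      linarith
    · generalize Int.floor ((x + d i) / Q i) = k at hfl
      have hk : (k : ℝ) ≤ x / (Q i - d i) := by
        rcases le_or_gt k 0 with hk | hk
        · have : (k : ℝ) ≤ 0 := by exact_mod_cast hk
          exact this.trans (by positivity)
        · have hk1 : (1 : ℝ) ≤ k := by exact_mod_cast hk
          rw [le_div_iff₀ hQi] at hfl
          rw [le_div_iff₀ hpos]
          nlinarith
      have h1 := mul_le_mul_of_nonneg_right hk hQj.le
      have h2 : x / (Q i - d i) * Q j = Q j / (Q i - d i) * x := by ring
      linarith
  · have key : ∀ a b A B t : ℝ, 0 ≤ a → 0 ≤ b → 0 ≤ t → t ≤ 1 → A ≤ h a → B ≤ h b →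
        (1 - t) * A + t * B ≤ h ((1 - t) * a + t * b) := by
      intro a b A B t ha hb ht0 ht1 hA hB
      have h1 := hc.2 (Set.mem_Ici.2 ha) (Set.mem_Ici.2 hb)
        (sub_nonneg.2 ht1) ht0 (by ring)
      simp only [smul_eq_mul] at h1
      have h2 := mul_le_mul_of_nonneg_left hA (sub_nonneg.2 ht1)
      have h3 := mul_le_mul_of_nonneg_left hB ht0
      linarith
    have hp : ∀ k : ℤ, 1 ≤ k → 0 ≤ k * Q i - d i ∧
        k * Q j + Q j + d j ≤ h (k * Q i - d i) := by
      intro k hk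
      have hk1 : (1 : ℝ) ≤ k := by exact_mod_cast hk
      have h0 : 0 ≤ k * Q i - d i := by nlinarith
      refine ⟨h0, ?_⟩
      have h1 := hh _ h0
      unfold phi at h1
      rwa [sub_add_cancel, mul_div_cancel_right₀ _ hQi.ne', Int.floor_intCast] at h1
    rcases le_total x (Q i - d i) with hxl | hxg
    · refine (min_le_right _ _).trans ?_
      have h0 := hh 0 le_rfl
      have hf : Int.floor ((0 + d i) / Q i) = 0 := by
        rw [Int.floor_eq_zero_iff, Set.mem_Ico, zero_add]
        exact ⟨by positivity, (div_lt_one hQi).2 hdQ⟩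
      unfold phi at h0
      rw [hf] at h0
      obtain ⟨h1, h2⟩ := hp 1 le_rfl
      have h3 := key _ _ _ _ (x / (Q i - d i)) le_rfl h1 (by positivity)
        ((div_le_one hpos).2 hxl) h0 h2
      have e : (1 - x / (Q i - d i)) * 0 + x / (Q i - d i) * (((1 : ℤ) : ℝ) * Q i - d i) = x := by
        push_cast
        rw [one_mul, mul_zero, zero_add, div_mul_cancel₀ _ hpos.ne']
      rw [e] at h3
      refine le_trans (le_of_eq ?_) h3
      push_cast
      ring
    · refine (min_le_left _ _).trans ?_
      have hk : 1 ≤ Int.floor ((x + d i) / Q i) := by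
        rw [Int.le_floor, le_div_iff₀ hQi]
        push_cast
        linarith
      have hu : (x + d i) / Q i * Q i = x + d i := div_mul_cancel₀ _ hQi.ne'
      have hu2 : Q j / Q i * (x + d i) = (x + d i) / Q i * Q j := by ring
      rw [hu2]
      generalize (x + d i) / Q i = u at *
      obtain ⟨h1, h2⟩ := hp _ hk
      obtain ⟨h3, h4⟩ := hp (Int.floor u + 1) (by linarith)
      have h5 := key _ _ _ _ (u - Int.floor u) h1 h3 (by linarith [Int.floor_le u])
        (by linarith [Int.lt_floor_add_one u]) h2 h4
      push_cast at h5
      have e : (1 - (u - (Int.floor u : ℝ))) * (Int.floor u * Q i - d i)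
          + (u - Int.floor u) * ((Int.floor u + 1) * Q i - d i) = x := by
        linear_combination hu
      rw [e] at h5
      refine le_trans (le_of_eq ?_) h5
      ring
end

section
/- (Lemma 2 of the appendix, strict service curve for flow i given arrival-constrained outputs of the flows in the complement of J.) Let A_1,…,A_n and D_1,…,D_n be nondecreasing cumulative input/output functions on ℝ≥0 with D_j ≤ A_j and A_j(0) = D_j(0) = 0, let β : ℝ≥0 → ℝ≥0 be nondecreasing, let N_i = {1,…,n}\{i}, let J ⊆ N_i and J̄ = N_i \ J, and for j ∈ J̄ let α*_j : ℝ≥0 → ℝ≥0 be nondecreasing. Assume: (i) for every interval (s,t] that is backlogged for flow i (A_i(u) > D_i(u) for all u ∈ (s,t]), Σ_{j=1}^n (D_j(t) − D_j(s)) ≥ β(t−s); (ii) for every such interval and every j ∈ J, D_j(t) − D_j(s) ≤ φ_{i,j}(D_i(t) − D_i(s)); (iii) for every such interval and every j ∈ J̄, D_j(t) − D_j(s) ≤ α*_j(t−s). Then for every interval (s,t] backlogged for flow i, D_i(t) − D_i(s) ≥ γ_i^J( [β − Σ_{j∈J̄} α*_j]^+↑ (t−s) ), where γ_i^J = (ψ_i^J)↓.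 -/
open Finset Set

theorem strict_service_curve_with_constrained_interferers {n : ℕ} (hn : 2 ≤ n) (Q d : Fin n → ℝ)
    (hQ : ∀ j, 0 < Q j) (hd : ∀ j, 0 ≤ d j ∧ d j < Q j) (i : Fin n)
    (A D : Fin n → ℝ → ℝ) (β : ℝ → ℝ) (J : Finset (Fin n))
    (hJ : J ⊆ Finset.univ.erase i) (αstar : Fin n → ℝ → ℝ)
    (hA : ∀ j, MonotoneOn (A j) (Set.Ici 0)) (hD : ∀ j, MonotoneOn (D j) (Set.Ici 0))
    (hDA : ∀ j, ∀ t : ℝ, 0 ≤ t → D j t ≤ A j t)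
    (hA0 : ∀ j, A j 0 = 0) (hD0 : ∀ j, D j 0 = 0)
    (hβ : MonotoneOn β (Set.Ici 0))
    (hαstar : ∀ j ∈ Finset.univ.erase i \ J, MonotoneOn (αstar j) (Set.Ici 0))
    (hagg : ∀ s t : ℝ, 0 ≤ s → s ≤ t → (∀ u ∈ Set.Ioc s t, D i u < A i u) →
      β (t - s) ≤ ∑ j, (D j t - D j s))
    (hphi : ∀ s t : ℝ, 0 ≤ s → s ≤ t → (∀ u ∈ Set.Ioc s t, D i u < A i u) →
      ∀ j ∈ J, D j t - D j s ≤ phi Q d i j (D i t - D i s))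
    (hout : ∀ s t : ℝ, 0 ≤ s → s ≤ t → (∀ u ∈ Set.Ioc s t, D i u < A i u) →
      ∀ j ∈ Finset.univ.erase i \ J, D j t - D j s ≤ αstar j (t - s)) :
    ∀ s t : ℝ, 0 ≤ s → s ≤ t → (∀ u ∈ Set.Ioc s t, D i u < A i u) →
      lpi (psiJ Q d i J)
          (posNdClosure
            (fun u => β u - ∑ j ∈ Finset.univ.erase i \ J, αstar j u) (t - s))
        ≤ D i t - D i s := by
  intro s t hs hst hb
  have hphimono : ∀ j : Fin n, ∀ x y : ℝ, x ≤ y → phi Q d i j x ≤ phi Q d i j y := by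
    intro j x y hxy
    unfold phi
    have h1 : (x + d i) / Q i ≤ (y + d i) / Q i :=
      div_le_div_of_nonneg_right (by linarith) (hQ i).le
    have h2 : ((Int.floor ((x + d i) / Q i) : ℤ) : ℝ) ≤ (Int.floor ((y + d i) / Q i) : ℤ) := by
      exact_mod_cast Int.floor_le_floor h1
    have h3 := mul_le_mul_of_nonneg_right h2 (hQ j).le
    linarith
  have hmono : ∀ x y : ℝ, x ≤ y → psiJ Q d i J x ≤ psiJ Q d i J y := by
    intro x y hxy
    unfold psiJ
    exact add_le_add hxy (Finset.sum_le_sum fun j _ => hphimono j x y hxy)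
  have hx : 0 ≤ D i t - D i s := sub_nonneg.2 (hD i hs (hs.trans hst) hst)
  have hpos : 0 ≤ psiJ Q d i J (D i t - D i s) := by
    refine le_trans ?_ (hmono 0 _ hx)
    unfold psiJ phi
    have : (0 : ℤ) ≤ Int.floor ((0 + d i) / Q i) :=
      Int.floor_nonneg.2 (div_nonneg (by linarith [(hd i).1]) (hQ i).le)
    have h0 : (0 : ℝ) ≤ (Int.floor ((0 + d i) / Q i) : ℤ) := by exact_mod_cast this
    refine add_nonneg le_rfl (Finset.sum_nonneg fun j _ => ?_)
    have := mul_nonneg h0 (hQ j).le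
    linarith [hQ j, (hd j).1]
  unfold lpi
  refine csInf_le ⟨0, fun x h => h.1⟩ ⟨hx, ?_⟩
  unfold posNdClosure
  refine csSup_le ((Set.nonempty_Icc.2 (sub_nonneg.2 hst)).image _) ?_
  rintro _ ⟨v, ⟨hv0, hv1⟩, rfl⟩
  refine max_le ?_ hpos
  have hsv : s ≤ s + v := by linarith
  have hvt : s + v ≤ t := by linarith
  have hb' : ∀ u ∈ Set.Ioc s (s + v), D i u < A i u :=
    fun u hu => hb u ⟨hu.1, hu.2.trans hvt⟩
  have e1 := hagg s (s + v) hs hsv hb'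
  have e2 := Finset.sum_le_sum (hphi s (s + v) hs hsv hb')
  have e3 := Finset.sum_le_sum (hout s (s + v) hs hsv hb')
  have hDD : D i (s + v) ≤ D i t := hD i (hs.trans hsv) (hs.trans hst) hvt
  have e4 := hmono (D i (s + v) - D i s) (D i t - D i s) (by linarith)
  rw [← Finset.add_sum_erase Finset.univ _ (Finset.mem_univ i), ← Finset.sum_sdiff hJ] at e1
  simp only [add_sub_cancel_left] at e1 e3
  refine le_trans ?_ e4
  show β v - ∑ j ∈ Finset.univ.erase i \ J, αstar j v ≤ _
  unfold psiJ
  linarith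
end

section
/- (Corollary 3, the simple mapping lower-bounds the full mapping.) Let β, β_1^old,…,β_n^old, α_1,…,α_n : ℝ≥0 → ℝ≥0 be nondecreasing, with (α_j ⊘ β_j^old)(t) finite for all t. Let N_i = {1,…,n}\{i} and for J ⊆ N_i let J̄ = N_i \ J and γ_i^J = (ψ_i^J)↓; note γ_i = γ_i^{N_i}. Define δ_i(t) = Σ_{j≠i} [ φ_{i,j}(β_i^old(t)) − (α_j ⊘ β_j^old)(t) ]^+, β_i^new = max( β_i^old , max_{J ⊆ N_i} γ_i^J ∘ [β − Σ_{j∈J̄}(α_j ⊘ β_j^old)]^+↑ ), and β̄_i^new = max( β_i^old , γ_i ∘ (β + δ_i)↑ ). Then β̄_i^new(t) ≤ β_i^new(t) for all t ≥ 0. -/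
open Finset Set

theorem mpDeconv_mono_aux (f g : ℝ → ℝ) (hf : MonotoneOn f (Set.Ici 0))
    (hb : ∀ t : ℝ, BddAbove ((fun s => f (t + s) - g s) '' Set.Ici 0))
    {a b : ℝ} (ha : 0 ≤ a) (hab : a ≤ b) : mpDeconv f g a ≤ mpDeconv f g b := by
  unfold mpDeconv
  apply csSup_le (Set.Nonempty.image _ ⟨0, Set.mem_Ici.2 le_rfl⟩)
  rintro _ ⟨s, hs, rfl⟩
  have hs' : (0 : ℝ) ≤ s := hs
  have h1 : f (a + s) ≤ f (b + s) :=
    hf (Set.mem_Ici.2 (by linarith)) (Set.mem_Ici.2 (by linarith)) (by linarith)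
  have h2 : f (b + s) - g s ≤ sSup ((fun s => f (b + s) - g s) '' Set.Ici 0) :=
    le_csSup (hb b) ⟨s, hs, rfl⟩
  show f (a + s) - g s ≤ _
  linarith

theorem phi_mono_aux {n : ℕ} (Q d : Fin n → ℝ) (hQ : ∀ j, 0 < Q j) (i j : Fin n) {x y : ℝ}
    (h : x ≤ y) : phi Q d i j x ≤ phi Q d i j y := by
  unfold phi
  have h1 : (x + d i) / Q i ≤ (y + d i) / Q i :=
    div_le_div_of_nonneg_right (by linarith) (hQ i).le
  have h2 : ((Int.floor ((x + d i) / Q i) : ℤ) : ℝ) ≤ (Int.floor ((y + d i) / Q i) : ℤ) := by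
    exact_mod_cast Int.floor_le_floor h1
  have := mul_le_mul_of_nonneg_right h2 (hQ j).le
  linarith

theorem phi_nonneg_aux {n : ℕ} (Q d : Fin n → ℝ) (hQ : ∀ j, 0 < Q j) (hd : ∀ j, 0 ≤ d j)
    (i j : Fin n) {x : ℝ} (h : 0 ≤ x) : 0 ≤ phi Q d i j x := by
  unfold phi
  have h1 : 0 ≤ (x + d i) / Q i := div_nonneg (add_nonneg h (hd i)) (hQ i).le
  have h2 : (0 : ℝ) ≤ (Int.floor ((x + d i) / Q i) : ℤ) := by
    exact_mod_cast Int.floor_nonneg.2 h1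
  have := mul_nonneg h2 (hQ j).le
  linarith [hQ j, hd j]

theorem le_psiJ_of_lpi_lt_aux {n : ℕ} (Q d : Fin n → ℝ) (hQ : ∀ j, 0 < Q j)
    (hd : ∀ j, 0 ≤ d j) (i : Fin n) (J : Finset (Fin n)) {x y : ℝ}
    (h : lpi (psiJ Q d i J) y < x) : y ≤ psiJ Q d i J x := by
  have hne : {x : ℝ | 0 ≤ x ∧ y ≤ psiJ Q d i J x}.Nonempty := by
    refine ⟨max y 0, le_max_right _ _, ?_⟩
    unfold psiJ
    have : 0 ≤ ∑ j ∈ J, phi Q d i j (max y 0) :=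
      Finset.sum_nonneg fun j _ => phi_nonneg_aux Q d hQ hd i j (le_max_right _ _)
    linarith [le_max_left y 0]
  obtain ⟨z, ⟨_, hz⟩, hzx⟩ := exists_lt_of_csInf_lt hne h
  refine hz.trans ?_
  unfold psiJ
  have : ∑ j ∈ J, phi Q d i j z ≤ ∑ j ∈ J, phi Q d i j x :=
    Finset.sum_le_sum fun j _ => phi_mono_aux Q d hQ i j hzx.le
  linarith

theorem simple_mapping_le_full_mapping {n : ℕ} (hn : 2 ≤ n) (Q d : Fin n → ℝ)
    (hQ : ∀ j, 0 < Q j) (hd : ∀ j, 0 ≤ d j ∧ d j < Q j) (i : Fin n)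
    (β : ℝ → ℝ) (α βold : Fin n → ℝ → ℝ)
    (hβ : MonotoneOn β (Set.Ici 0))
    (hα : ∀ j, MonotoneOn (α j) (Set.Ici 0))
    (hβold : ∀ j, MonotoneOn (βold j) (Set.Ici 0))
    (hfin : ∀ j, ∀ t : ℝ, BddAbove ((fun s => α j (t + s) - βold j s) '' Set.Ici 0)) :
    ∀ t : ℝ, 0 ≤ t →
      max (βold i t)
          (lpi (psi Q d i)
            (ndClosure
              (fun u => β u +
                ∑ j ∈ Finset.univ.erase i,
                  pospart (phi Q d i j (βold i u) - mpDeconv (α j) (βold j) u)) t))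
        ≤ max (βold i t)
            ((Finset.univ.erase i).powerset.sup' (Finset.powerset_nonempty _)
              (fun J => lpi (psiJ Q d i J)
                (posNdClosure
                  (fun u => β u - ∑ j ∈ Finset.univ.erase i \ J, mpDeconv (α j) (βold j) u)
                  t))) := by
  intro t ht
  refine max_le (le_max_left _ _) ?_
  refine le_of_forall_gt_imp_ge_of_dense ?_
  intro x hx
  obtain ⟨hxM, hxS⟩ := max_lt_iff.1 hx
  rw [Finset.sup'_lt_iff] at hxS
  have hx0 : 0 ≤ x := by
    have h1 := hxS ∅ (Finset.empty_mem_powerset _)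
    refine le_trans ?_ h1.le
    exact Real.sInf_nonneg fun z hz => hz.1
  refine csInf_le ⟨0, fun z hz => hz.1⟩ ⟨hx0, ?_⟩
  refine csSup_le (Set.Nonempty.image _ ⟨0, Set.mem_Icc.2 ⟨le_rfl, ht⟩⟩) ?_
  rintro _ ⟨u, hu, rfl⟩
  have hu0 : 0 ≤ u := hu.1
  have hut : u ≤ t := hu.2
  set N : Finset (Fin n) := Finset.univ.erase i with hN
  set K : Finset (Fin n) :=
    N.filter (fun j => 0 ≤ phi Q d i j (βold i u) - mpDeconv (α j) (βold j) u) with hK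
  have hKN : K ⊆ N := Finset.filter_subset _ _
  have hJ := le_psiJ_of_lpi_lt_aux Q d hQ (fun j => (hd j).1) i (N \ K)
    (hxS (N \ K) (Finset.mem_powerset.2 Finset.sdiff_subset))
  rw [Finset.sdiff_sdiff_eq_self hKN] at hJ
  have hle : β u - ∑ j ∈ K, mpDeconv (α j) (βold j) u ≤
      posNdClosure (fun u => β u - ∑ j ∈ K, mpDeconv (α j) (βold j) u) t := by
    refine le_trans (le_max_left _ 0) (le_csSup ?_ ⟨u, hu, rfl⟩)
    refine ⟨max (β t - ∑ j ∈ K, mpDeconv (α j) (βold j) 0) 0, ?_⟩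
    rintro _ ⟨v, hv, rfl⟩
    refine max_le_max ?_ le_rfl
    have h1 : β v ≤ β t := hβ hv.1 ht hv.2
    have h2 : ∑ j ∈ K, mpDeconv (α j) (βold j) 0 ≤ ∑ j ∈ K, mpDeconv (α j) (βold j) v :=
      Finset.sum_le_sum fun j _ => mpDeconv_mono_aux _ _ (hα j) (hfin j) le_rfl hv.1
    linarith
  have hpos : ∑ j ∈ N, pospart (phi Q d i j (βold i u) - mpDeconv (α j) (βold j) u) =
      ∑ j ∈ K, (phi Q d i j (βold i u) - mpDeconv (α j) (βold j) u) := by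
    rw [hK, Finset.sum_filter]
    refine Finset.sum_congr rfl fun j _ => ?_
    unfold pospart
    split_ifs with h
    · exact max_eq_left h
    · exact max_eq_right (not_le.1 h).le
  have hphi : ∑ j ∈ K, phi Q d i j (βold i u) ≤ ∑ j ∈ K, phi Q d i j x :=
    Finset.sum_le_sum fun j _ =>
      phi_mono_aux Q d hQ i j ((hβold i hu0 ht hut).trans hxM.le)
  have hsplit := Finset.sum_sdiff (f := fun j => phi Q d i j x) hKN
  show β u + ∑ j ∈ N, pospart (phi Q d i j (βold i u) - mpDeconv (α j) (βold j) u) ≤ _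
  rw [hpos, Finset.sum_sub_distrib]
  unfold psi
  unfold psiJ at hJ
  rw [← hN]
  linarith
end

section
/- (Explicit formula for the min-plus convolution of the unit-rate function with a stair function.) Let a, b be reals with 0 < a ≤ b, let λ_1(t) = t and ν_{a,b}(t) = a·⌈t/b⌉ for t ≥ 0. Then for every t ≥ 0, (λ_1 ⊗ ν_{a,b})(t) = min( a·⌊t/b⌋ + (t − b·⌊t/b⌋) , a·(⌊t/b⌋ + 1) ). -/
open Finset Set

theorem mpConv_unit_rate_stair (a b : ℝ) (ha : 0 < a) (hab : a ≤ b) :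
    ∀ t : ℝ, 0 ≤ t →
      mpConv (fun s => s) (stair a b) t =
        min (a * (Int.floor (t / b) : ℝ) + (t - b * (Int.floor (t / b) : ℝ)))
            (a * ((Int.floor (t / b) : ℝ) + 1)) := by
  intro t ht
  have hb : 0 < b := lt_of_lt_of_le ha hab
  have hk0 : (0:ℝ) ≤ (Int.floor (t / b) : ℝ) := by
    exact_mod_cast Int.floor_nonneg.mpr (div_nonneg ht hb.le)
  have hkt : b * (Int.floor (t / b) : ℝ) ≤ t := by
    have h := Int.floor_le (t / b)
    rw [le_div_iff₀ hb] at h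
    linarith
  have hlow : ∀ y ∈ (fun s => (t - s) + stair a b s) '' Set.Icc 0 t,
      min (a * (Int.floor (t / b) : ℝ) + (t - b * (Int.floor (t / b) : ℝ)))
            (a * ((Int.floor (t / b) : ℝ) + 1)) ≤ y := by
    rintro y ⟨s, ⟨hs0, hst⟩, rfl⟩
    simp only [stair]
    have hc := Int.le_ceil (s / b)
    rw [div_le_iff₀ hb] at hc
    rcases le_or_gt (Int.ceil (s / b)) (Int.floor (t / b)) with h | h
    · refine (min_le_left _ _).trans ?_
      have h' : (Int.ceil (s / b) : ℝ) ≤ (Int.floor (t / b) : ℝ) := by exact_mod_cast h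
      nlinarith [mul_nonneg (sub_nonneg.2 hab) (sub_nonneg.2 h')]
    · refine (min_le_right _ _).trans ?_
      have h' : (Int.floor (t / b) : ℝ) + 1 ≤ (Int.ceil (s / b) : ℝ) := by exact_mod_cast h
      nlinarith [mul_le_mul_of_nonneg_left h' ha.le]
  have hbdd : BddBelow ((fun s => (t - s) + stair a b s) '' Set.Icc 0 t) := ⟨_, hlow⟩
  unfold mpConv
  apply le_antisymm
  · apply le_min
    · refine csInf_le hbdd ⟨b * (Int.floor (t / b) : ℝ), ⟨by positivity, hkt⟩, ?_⟩
      simp only [stair]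
      rw [mul_div_cancel_left₀ _ hb.ne', Int.ceil_intCast]
      ring
    · refine (csInf_le hbdd ⟨t, ⟨ht, le_rfl⟩, rfl⟩).trans ?_
      simp only [stair, sub_self, zero_add]
      apply mul_le_mul_of_nonneg_left _ ha.le
      exact_mod_cast Int.ceil_le_floor_add_one (t / b)
  · exact le_csInf ⟨_, ⟨t, ⟨ht, le_rfl⟩, rfl⟩⟩ hlow
end
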